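/- Let A be a finite set, let m ≥ 3, and let f₁,…,f_m : A → {-1,1} satisfy |⟨f_i,f_j⟩| ≤ 1/m for all i ≠ j, where ⟨f,g⟩ = E_{a∈A}[f(a)·g(a)]. Then the family {f₁,…,f_m} is (1/m, 1/m)-almost orthogonal, and consequently the matrix N : {1,…,m} × A → {-1,1} defined by N(i,a) = f_i(a) is a (k,ℓ)-L₂-extractor with error 2^{-r}, where k = (1/2)·log₂ m and ℓ = r = (1/4)·log₂(1/(1/m + m^{-1/2})). -/

import Mathlib

open Finset

attribute [local instance] Classical.propDecidable

/-- Expectation with respect to the uniform distribution on a finite set. -/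
noncomputable def expE {X : Type*} [Fintype X] (f : X → ℝ) : ℝ :=
  (∑ x, f x) / (Fintype.card X)

/-- Inner product with respect to the uniform distribution. -/
noncomputable def nInner {X : Type*} [Fintype X] (f g : X → ℝ) : ℝ :=
  expE (fun x => f x * g x)

/-- Normalized ℓ₁-norm. -/
noncomputable def nNorm1 {X : Type*} [Fintype X] (f : X → ℝ) : ℝ :=
  expE (fun x => |f x|)

/-- Normalized ℓ₂-norm. -/
noncomputable def nNorm2 {X : Type*} [Fintype X] (f : X → ℝ) : ℝ :=
  Real.sqrt (expE (fun x => (f x) ^ 2))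

/-- `M` is a `(k,ℓ)`-L₂-extractor with error `2^{-r}`. -/
def IsL2Extractor {A X : Type*} [Fintype A] [Fintype X]
    (M : A → X → ℝ) (k ℓ r : ℝ) : Prop :=
  ∀ f : X → ℝ, (∀ x, 0 ≤ f x) → f ≠ 0 →
    nNorm2 f ≤ (2 : ℝ) ^ ℓ * nNorm1 f →
    ((Finset.univ.filter
        (fun a : A => (2 : ℝ) ^ (-r) * nNorm1 f ≤ |nInner (M a) f|)).card : ℝ)
      ≤ (2 : ℝ) ^ (-k) * (Fintype.card A)

/-- A family of `±1`-valued vectors `v i : X → ℝ` indexed by a finite set `I`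
is `(ε,δ)`-almost orthogonal: for every `i` there are at most `δ·|I|` indices
`j` with `|⟨v i, v j⟩| > ε`. -/
def AlmostOrtho {I X : Type*} [Fintype I] [Fintype X]
    (v : I → X → ℝ) (ε δ : ℝ) : Prop :=
  ∀ i : I,
    ((Finset.univ.filter (fun j : I => ε < |nInner (v i) (v j)|)).card : ℝ)
      ≤ δ * (Fintype.card I : ℝ)

theorem nInner_sum_left {ι X : Type*} [Fintype X] (s : Finset ι) (c : ι → ℝ) (u : ι → X → ℝ)
    (v : X → ℝ) :
    nInner (fun x => ∑ i ∈ s, c i * u i x) v = ∑ i ∈ s, c i * nInner (u i) v := by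
  simp only [nInner, expE, mul_div_assoc', Finset.mul_sum, ← Finset.sum_div, Finset.sum_mul]
  rw [Finset.sum_comm]
  simp only [mul_assoc]

theorem nInner_comm {X : Type*} [Fintype X] (u v : X → ℝ) : nInner u v = nInner v u := by
  simp only [nInner, mul_comm]

theorem sq_nInner_le {X : Type*} [Fintype X] (u v : X → ℝ) :
    nInner u v ^ 2 ≤ nInner u u * nInner v v := by
  simp only [nInner, expE]
  rw [div_pow, div_mul_div_comm, ← sq]
  have h := Finset.sum_mul_sq_le_sq_mul_sq Finset.univ u v
  simp only [sq (u _), sq (v _)] at h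
  gcongr

theorem nNorm2_sq {X : Type*} [Fintype X] (u : X → ℝ) : nNorm2 u ^ 2 = nInner u u := by
  rw [nNorm2, Real.sq_sqrt]
  · simp only [nInner, sq]
  · exact div_nonneg (Finset.sum_nonneg fun _ _ => sq_nonneg _) (Nat.cast_nonneg _)

theorem nNorm1_pos {X : Type*} [Fintype X] {u : X → ℝ} (hu : u ≠ 0) : 0 < nNorm1 u := by
  obtain ⟨x, hx⟩ := Function.ne_iff.mp hu
  have : Nonempty X := ⟨x⟩
  exact div_pos (Finset.sum_pos' (fun _ _ => abs_nonneg _) ⟨x, Finset.mem_univ x, abs_pos.mpr hx⟩)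
    (Nat.cast_pos.mpr Fintype.card_pos)

/-- A signed sum of unit vectors with pairwise inner products at most `ε` has squared norm at most
`|s| + ε |s|²`. -/
theorem nInner_signed_sum_self_le {ι X : Type*} [Fintype X] (s : Finset ι) (c : ι → ℝ)
    (u : ι → X → ℝ) {ε : ℝ} (hε : 0 ≤ ε) (hc : ∀ i, |c i| ≤ 1) (hu : ∀ i, nInner (u i) (u i) ≤ 1)
    (h : ∀ i j, i ≠ j → |nInner (u i) (u j)| ≤ ε) :
    nInner (fun x => ∑ i ∈ s, c i * u i x) (fun x => ∑ i ∈ s, c i * u i x)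
      ≤ s.card + ε * (s.card : ℝ) ^ 2 := by
  have key : ∀ i j, c i * (c j * nInner (u j) (u i)) ≤ (if i = j then 1 else 0) + ε := by
    intro i j
    have hcc : |c i * c j| ≤ 1 := by
      rw [abs_mul]
      exact mul_le_one₀ (hc i) (abs_nonneg _) (hc j)
    rw [← mul_assoc]
    refine (le_abs_self _).trans ?_
    rw [abs_mul]
    refine (mul_le_of_le_one_left (abs_nonneg _) hcc).trans ?_
    split_ifs with hij
    · subst hij
      have h0 : 0 ≤ nInner (u i) (u i) := by
        rw [← nNorm2_sq]
        positivity
      rw [abs_of_nonneg h0]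
      linarith [hu i]
    · simpa using h j i (Ne.symm hij)
  rw [nInner_sum_left]
  calc ∑ i ∈ s, c i * nInner (u i) (fun x => ∑ j ∈ s, c j * u j x)
      = ∑ i ∈ s, ∑ j ∈ s, c i * (c j * nInner (u j) (u i)) := by
        refine Finset.sum_congr rfl fun i _ => ?_
        rw [nInner_comm, nInner_sum_left, Finset.mul_sum]
    _ ≤ ∑ i ∈ s, ∑ j ∈ s, ((if i = j then 1 else 0) + ε) :=
        Finset.sum_le_sum fun i _ => Finset.sum_le_sum fun j _ => key i j
    _ = s.card + ε * (s.card : ℝ) ^ 2 := by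
        simp only [Finset.sum_add_distrib, Finset.sum_ite_eq, Finset.sum_const, nsmul_eq_mul]
        rw [Finset.sum_congr rfl fun i hi => if_pos hi]
        simp only [Finset.sum_const, nsmul_eq_mul]
        ring

/-- Few vectors of an almost orthonormal family correlate well with a fixed vector: if each
`|⟨u i, g⟩|` with `i ∈ s` is at least `t`, then `|s| t² ≤ (1 + ε |s|) ‖g‖₂²`. -/
theorem card_mul_sq_le_of_le_abs_nInner {ι X : Type*} [Fintype X] (s : Finset ι)
    (u : ι → X → ℝ) (g : X → ℝ) {ε t : ℝ} (hε : 0 ≤ ε) (ht : 0 ≤ t)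
    (hu : ∀ i, nInner (u i) (u i) ≤ 1) (h : ∀ i j, i ≠ j → |nInner (u i) (u j)| ≤ ε)
    (hg : ∀ i ∈ s, t ≤ |nInner (u i) g|) :
    s.card * t ^ 2 ≤ (1 + ε * s.card) * nInner g g := by
  have hgg : 0 ≤ nInner g g := by
    rw [← nNorm2_sq]
    positivity
  set c : ι → ℝ := fun i => SignType.sign (nInner (u i) g) with hcdef
  have hc : ∀ i, |c i| ≤ 1 := by
    intro i
    simp only [hcdef]
    rcases SignType.sign (nInner (u i) g) with _ | _ | _ <;> simp
  have hlow : s.card * t ≤ nInner (fun x => ∑ i ∈ s, c i * u i x) g := by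
    rw [nInner_sum_left, ← nsmul_eq_mul]
    refine Finset.card_nsmul_le_sum s _ t fun i hi => ?_
    simpa only [hcdef, sign_mul_self] using hg i hi
  have hsq := sq_nInner_le (fun x => ∑ i ∈ s, c i * u i x) g
  have hub := nInner_signed_sum_self_le s c u hε hc hu h
  rcases s.eq_empty_or_nonempty with rfl | hs
  · simpa using hgg
  have hpos : (0 : ℝ) < s.card := by exact_mod_cast hs.card_pos
  refine le_of_mul_le_mul_left ?_ hpos
  calc (s.card : ℝ) * (s.card * t ^ 2) = (s.card * t) ^ 2 := by ring
    _ ≤ nInner (fun x => ∑ i ∈ s, c i * u i x) g ^ 2 := by gcongr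
    _ ≤ _ := hsq
    _ ≤ (s.card + ε * (s.card : ℝ) ^ 2) * nInner g g := by gcongr
    _ = s.card * ((1 + ε * s.card) * nInner g g) := by ring

theorem nInner_self_le_one {X : Type*} [Fintype X] {u : X → ℝ} (hu : ∀ x, u x = 1 ∨ u x = -1) :
    nInner u u ≤ 1 := by
  have h : ∀ x, u x * u x = 1 := fun x => by rcases hu x with h | h <;> simp [h]
  simpa [nInner, expE, h] using div_self_le_one (Fintype.card X : ℝ)

/-- **Corollary (statistical-query dimension).**
If `f₁, …, f_m : A → {-1,1}` (`m ≥ 3`) satisfy `|⟨f_i,f_j⟩| ≤ 1/m` for all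
`i ≠ j`, then the family is `(1/m, 1/m)`-almost orthogonal, and the matrix
`N : {1,…,m} × A → {-1,1}` with `N(i,a) = f_i(a)` is a `(k,ℓ)`-L₂-extractor
with error `2^{-r}`, where `k = ½·log₂ m` and
`ℓ = r = ¼·log₂(1/(1/m + m^{-1/2}))`. -/
theorem sq_dimension_l2Extractor (A : Type*) [Fintype A]
    (m : ℕ) (hm : 3 ≤ m)
    (f : Fin m → A → ℝ) (hf : ∀ i a, f i a = 1 ∨ f i a = -1)
    (horth : ∀ i j : Fin m, i ≠ j → |nInner (f i) (f j)| ≤ 1 / m) :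
    AlmostOrtho f (1 / m) (1 / m) ∧
    IsL2Extractor (fun (i : Fin m) (a : A) => f i a)
      (1 / 2 * Real.logb 2 m)
      (1 / 4 * Real.logb 2 (1 / (1 / m + (m : ℝ) ^ (-(1 : ℝ) / 2))))
      (1 / 4 * Real.logb 2 (1 / (1 / m + (m : ℝ) ^ (-(1 : ℝ) / 2)))) := by
  have hm0 : (0 : ℝ) < m := by exact_mod_cast (by omega : 0 < m)
  constructor
  · intro i
    have hsub : (Finset.univ.filter (fun j : Fin m => 1 / (m : ℝ) < |nInner (f i) (f j)|)) ⊆ {i} := by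
      intro j hj
      rw [Finset.mem_singleton]
      by_contra hne
      exact absurd (horth i j (Ne.symm hne)) (not_le.mpr (Finset.mem_filter.mp hj).2)
    have hcard := Finset.card_le_card hsub
    rw [Finset.card_singleton] at hcard
    rw [Fintype.card_fin, one_div_mul_cancel hm0.ne']
    exact_mod_cast hcard
  · intro g _ hg0 hg
    set q : ℝ := (m : ℝ) ^ (-(1 : ℝ) / 2) with hq
    have hqpos : 0 < q := Real.rpow_pos_of_pos hm0 _
    set c : ℝ := 1 / m + q with hc
    have hcpos : 0 < c := by positivity
    set L : ℝ := 1 / 4 * Real.logb 2 (1 / c) with hL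
    set T := nNorm1 g
    have hT : 0 < T := nNorm1_pos hg0
    have hLpos : (0 : ℝ) < 2 ^ L := by positivity
    have hpow : ((2 : ℝ) ^ L) ^ 4 * c = 1 := by
      rw [← Real.rpow_mul_natCast (by norm_num), hL, mul_comm (1 / 4 : ℝ), mul_assoc]
      norm_num
      rw [Real.rpow_neg (by norm_num), Real.rpow_logb (by norm_num) (by norm_num) hcpos]
      exact inv_mul_cancel₀ hcpos.ne'
    have hk : (2 : ℝ) ^ (-(1 / 2 * Real.logb 2 m)) = q := by
      rw [show -(1 / 2 * Real.logb 2 (m : ℝ)) = Real.logb 2 m * (-1 / 2) by ring,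
        Real.rpow_mul (by norm_num), Real.rpow_logb (by norm_num) (by norm_num) hm0]
    have hqm : q * q * m = 1 := by
      rw [← Real.rpow_add hm0]
      norm_num
      rw [Real.rpow_neg_one]
      exact inv_mul_cancel₀ hm0.ne'
    rw [hk, Fintype.card_fin]
    set B := Finset.univ.filter (fun i : Fin m => (2 : ℝ) ^ (-L) * T ≤ |nInner (f i) g|)
    have hB := card_mul_sq_le_of_le_abs_nInner B f g (one_div_nonneg.mpr hm0.le)
      (by positivity : 0 ≤ (2 : ℝ) ^ (-L) * T) (fun i => nInner_self_le_one (hf i)) horth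
      fun i hi => (Finset.mem_filter.mp hi).2
    have hgg : nInner g g ≤ (2 ^ L * T) ^ 2 := by
      rw [← nNorm2_sq]
      exact pow_le_pow_left₀ (Real.sqrt_nonneg _) hg 2
    rw [Real.rpow_neg (by norm_num)] at hB
    set y : ℝ := 2 ^ L
    have hBc : (B.card : ℝ) * c ≤ 1 + 1 / m * B.card := by
      have h1 : (B.card : ℝ) * (y⁻¹ * T) ^ 2 ≤ (1 + 1 / m * B.card) * (y * T) ^ 2 :=
        hB.trans (by gcongr)
      have h2 : (B.card : ℝ) * (y⁻¹ * T) ^ 2 = B.card * c * (y * T) ^ 2 := by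
        have : (y⁻¹) ^ 2 = c * y ^ 2 := by
          field_simp
          linarith
        rw [mul_pow, mul_pow, this]
        ring
      rw [h2] at h1
      exact le_of_mul_le_mul_right h1 (by positivity)
    have hBq : (B.card : ℝ) * q ≤ 1 := by
      rw [hc] at hBc
      linarith
    refine le_of_mul_le_mul_right ?_ hqpos
    linarith
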